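/- arXiv:2506.20750 — 2 statements merged into one kernel-verified Lean document; each statement's English description precedes it below -/
import Mathlib

section
/- Let S ⊆ ℕ₀ be nonempty and let X = X_S be the S-gap shift, with h(X) = ln λ_S. Then there exist constants C > 0 and N₀ > 0 such that for every n > N₀ and every w ∈ L_n(X) that is not of the form 0u0 with u a word containing the symbol 1, one has 0 ≤ h(X) − h(X_w) ≤ C·λ_S^{−n}. -/
open Filter Topology

section SubshiftBasics

variable {A : Type*}

/-- The left shift map on bi-infinite sequences. -/
def shiftZ (x : ℤ → A) : ℤ → A := fun i => x (i + 1)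

/-- The word `w` occurs (as a subword) in the bi-infinite sequence `x`. -/
def occursIn (w : List A) (x : ℤ → A) : Prop :=
  ∃ i : ℤ, ∀ k : Fin w.length, x (i + (k : ℕ)) = w.get k

/-- A subshift: a closed, shift-invariant subset of `A^ℤ` (prodiscrete topology). -/
def IsSubshift [TopologicalSpace A] (X : Set (ℤ → A)) : Prop :=
  IsClosed X ∧ ∀ x ∈ X, shiftZ x ∈ X

/-- The language of `X`: all finite words occurring in points of `X`. -/
def language (X : Set (ℤ → A)) : Set (List A) :=
  { w | ∃ x ∈ X, occursIn w x }

/-- The words of length `n` in the language of `X`. -/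
def langN (X : Set (ℤ → A)) (n : ℕ) : Set (List A) :=
  { w | w ∈ language X ∧ w.length = n }

/-- Topological entropy of a subshift, `lim (1/n) log #L_n(X)` (as a limsup,
which agrees with the limit when the latter exists). -/
noncomputable def entropy (X : Set (ℤ → A)) : ℝ :=
  Filter.limsup (fun n : ℕ => Real.log ((langN X n).ncard) / n) Filter.atTop

/-- The perturbation `X_w`: points of `X` not containing `w` as a subword. -/
def perturb (X : Set (ℤ → A)) (w : List A) : Set (ℤ → A) :=
  { x ∈ X | ¬ occursIn w x }

/-- Multi-word perturbation `X_K`. -/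
def perturbFamily (X : Set (ℤ → A)) (K : Set (List A)) : Set (ℤ → A) :=
  { x ∈ X | ∀ w ∈ K, ¬ occursIn w x }

/-- Irreducibility of a subshift. -/
def IrreducibleSubshift (X : Set (ℤ → A)) : Prop :=
  ∀ u ∈ language X, ∀ w ∈ language X, ∃ v, u ++ v ++ w ∈ language X

/-- `m` is a synchronizing word for `X`. -/
def IsSynchronizingWord (X : Set (ℤ → A)) (m : List A) : Prop :=
  m ∈ language X ∧
    ∀ u v : List A, u ++ m ∈ language X → m ++ v ∈ language X → u ++ m ++ v ∈ language X

/-- A synchronized system: an irreducible subshift possessing a synchronizing word. -/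
def IsSynchronizedSystem (X : Set (ℤ → A)) : Prop :=
  IrreducibleSubshift X ∧ ∃ m, IsSynchronizingWord X m

end SubshiftBasics
section SGap

/-- The gap condition: between any two successive occurrences of `1` in `x`,
the number of `0`'s lies in `S`. -/
def gapsIn (S : Set ℕ) (x : ℤ → Fin 2) : Prop :=
  ∀ i j : ℤ, i < j → x i = 1 → x j = 1 → (∀ k : ℤ, i < k → k < j → x k = 0) →
    (j - i - 1).toNat ∈ S

/-- `1` occurs unboundedly in both directions. -/
def onesUnbounded (x : ℤ → Fin 2) : Prop :=
  (∀ n : ℤ, ∃ i > n, x i = 1) ∧ (∀ n : ℤ, ∃ i < n, x i = 1)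

/-- The `S`-gap shift: gaps between successive `1`'s lie in `S`; when `S` is finite,
`1` is required to occur infinitely often in both directions, while for infinite `S`
sequences beginning or ending with an infinite run of `0`'s are also allowed. -/
def SgapShift (S : Set ℕ) : Set (ℤ → Fin 2) :=
  { x | gapsIn S x ∧ (S.Infinite ∨ onesUnbounded x) }

/-- `T_R(z) = Σ_{n ∈ R} z^{-(n+1)}`. -/
noncomputable def TR (R : Set ℕ) (z : ℝ) : ℝ := ∑' n : R, (z ^ ((n : ℕ) + 1))⁻¹

/-- `S_m = { n − m : n ∈ S, n ≥ m }`. -/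
def shiftSet (S : Set ℕ) (m : ℕ) : Set ℕ := { p | ∃ n ∈ S, m ≤ n ∧ p = n - m }

/-- A word of the form `0^k u 0^{k'}` with `u` starting and ending with `1`,
`k, k' ∈ S ∪ {0}`, containing `w` as a subword. -/
def TildeForm (S : Set ℕ) (w v : List (Fin 2)) : Prop :=
  w <:+: v ∧ ∃ (k k' : ℕ) (u : List (Fin 2)),
    (k ∈ S ∨ k = 0) ∧ (k' ∈ S ∨ k' = 0) ∧ u.head? = some 1 ∧ u.getLast? = some 1 ∧
    v = List.replicate k 0 ++ u ++ List.replicate k' 0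

/-- `wt = w̃`: the smallest word of tilde form containing `w`. -/
def IsTilde (S : Set ℕ) (w wt : List (Fin 2)) : Prop :=
  TildeForm S w wt ∧ ∀ v, TildeForm S w v → wt.length ≤ v.length

end SGap

section Windows

variable {A : Type*}

/-- The word of length `n` read in `x` from position `i` on. -/
def window (x : ℤ → A) (i : ℤ) (n : ℕ) : List A := List.ofFn fun k : Fin n => x (i + (k : ℕ))

@[simp] lemma length_window (x : ℤ → A) (i : ℤ) (n : ℕ) : (window x i n).length = n := by
  simp [window]

lemma window_add (x : ℤ → A) (i : ℤ) (m n : ℕ) :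
    window x i (m + n) = window x i m ++ window x (i + m) n := by
  simp [window, List.ofFn_add, add_assoc]

lemma window_one (x : ℤ → A) (i : ℤ) : window x i 1 = [x i] := by
  simp [window]

lemma window_eq_iff {x : ℤ → A} {i : ℤ} {w : List A} :
    window x i w.length = w ↔ ∀ k : Fin w.length, x (i + (k : ℕ)) = w.get k := by
  conv_lhs => rhs; rw [← List.ofFn_get w]
  rw [window, List.ofFn_injective.eq_iff, funext_iff]

lemma window_eq_replicate {x : ℤ → A} {i : ℤ} {n : ℕ} {a : A}
    (h : ∀ k : ℕ, k < n → x (i + k) = a) : window x i n = List.replicate n a := by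
  rw [window, ← List.ofFn_const]
  congr 1
  ext1 k
  exact h k k.2

lemma occursIn_iff_window {w : List A} {x : ℤ → A} :
    occursIn w x ↔ ∃ i, window x i w.length = w := by
  simp only [occursIn, window_eq_iff]

lemma mem_langN_iff {X : Set (ℤ → A)} {n : ℕ} {w : List A} :
    w ∈ langN X n ↔ ∃ x ∈ X, ∃ i, window x i n = w := by
  simp only [langN, language, Set.mem_ofPred_eq, occursIn_iff_window]
  constructor
  · rintro ⟨⟨x, hx, i, hi⟩, rfl⟩
    exact ⟨x, hx, i, hi⟩
  · rintro ⟨x, hx, i, rfl⟩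
    exact ⟨⟨x, hx, i, by simp⟩, by simp⟩

lemma langN_mono {X Y : Set (ℤ → A)} (h : X ⊆ Y) (n : ℕ) : langN X n ⊆ langN Y n :=
  fun _ ⟨⟨x, hx, ho⟩, hn⟩ => ⟨⟨x, h hx, ho⟩, hn⟩

lemma finite_langN [Finite A] (X : Set (ℤ → A)) (n : ℕ) : (langN X n).Finite :=
  (List.finite_length_eq A n).subset fun _ h => h.2

lemma ncard_langN_mono [Finite A] {X Y : Set (ℤ → A)} (h : X ⊆ Y) (n : ℕ) :
    (langN X n).ncard ≤ (langN Y n).ncard :=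
  Set.ncard_le_ncard (langN_mono h n) (finite_langN Y n)

/-- A word of length `m` together with two words around it are read in some sequence. -/
lemma exists_window_eq (v p q : List A) (hp : p.length = q.length) (a : A) :
    ∃ x : ℤ → A, window x (-(p.length : ℤ)) (v.length + 2 * p.length) = p ++ v ++ q ∧
      window x 0 v.length = v := by
  let x : ℤ → A := fun j => (p ++ v ++ q).getD (j + p.length).toNat a
  have hx : window x (-(p.length : ℤ)) (p ++ v ++ q).length = p ++ v ++ q := by
    rw [window_eq_iff]
    intro k
    have : (-(p.length : ℤ) + (k : ℕ) + p.length).toNat = k := by omega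
    simp only [x, this, List.get_eq_getElem]
    exact List.getD_eq_getElem _ _ k.2
  have hl : (p ++ v ++ q).length = v.length + 2 * p.length := by simp; omega
  refine ⟨x, hl ▸ hx, ?_⟩
  have hl' : (p ++ v ++ q).length = p.length + (v.length + q.length) := by simp
  rw [hl', window_add, window_add, List.append_assoc] at hx
  have h1 := (List.append_inj hx (by simp)).2
  have h2 := (List.append_inj h1 (by simp)).1
  simpa using h2

end Windows

section FactorialLanguages

variable {A : Type*}

/-- The sequences all of whose finite windows lie in `V`. -/
def shiftOf (V : Set (List A)) : Set (ℤ → A) := { x | ∀ i n, window x i n ∈ V }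

/-- The words of length `n` that extend by `K` letters on both sides inside `V`. -/
def extN (V : Set (List A)) (K n : ℕ) : Set (List A) :=
  { v | v.length = n ∧ ∃ p q : List A, p.length = K ∧ q.length = K ∧ p ++ v ++ q ∈ V }

lemma finite_extN [Finite A] (V : Set (List A)) (K n : ℕ) : (extN V K n).Finite :=
  (List.finite_length_eq A n).subset fun _ h => h.1

lemma isClosed_window [Finite A] [TopologicalSpace A] [DiscreteTopology A] (i : ℤ) (n : ℕ)
    (V : Set (List A)) : IsClosed { x : ℤ → A | window x i n ∈ V } := by
  have hc : Continuous fun (x : ℤ → A) (k : Fin n) => x (i + (k : ℕ)) :=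
    continuous_pi fun k => continuous_apply _
  exact (isClosed_discrete { f : Fin n → A | List.ofFn f ∈ V }).preimage hc

lemma exists_extN_subset_langN [Finite A] [Nonempty A] {V : Set (List A)}
    (hV : ∀ v ∈ V, ∀ u, u <:+: v → u ∈ V) (m : ℕ) :
    ∃ K, extN V K m ⊆ langN (shiftOf V) m := by
  by_contra! hcon
  let _ : TopologicalSpace A := ⊥
  have : DiscreteTopology A := ⟨rfl⟩
  let F : ℕ → Set (ℤ → A) := fun K =>
    { x | window x (-(K : ℤ)) (m + 2 * K) ∈ V } ∩ { x | window x 0 m ∈ (langN (shiftOf V) m)ᶜ }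
  have hFc : ∀ K, IsClosed (F K) := fun K => (isClosed_window _ _ _).inter (isClosed_window _ _ _)
  have hFd : ∀ K, F (K + 1) ⊆ F K := by
    rintro K x ⟨h1, h2⟩
    refine ⟨hV _ h1 _ ⟨window x (-((K + 1 : ℕ) : ℤ)) 1, window x (m + K) 1, ?_⟩, h2⟩
    rw [show m + 2 * (K + 1) = 1 + (m + 2 * K) + 1 by ring, window_add _ _ (1 + (m + 2 * K)),
      window_add _ _ 1, show -((K + 1 : ℕ) : ℤ) + (1 : ℕ) = -K by push_cast; ring,
      show -((K + 1 : ℕ) : ℤ) + (1 + (m + 2 * K) : ℕ) = m + K by push_cast; ring]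
  have hFn : ∀ K, (F K).Nonempty := by
    intro K
    obtain ⟨v, ⟨hvm, p, q, hp, hq, hpq⟩, hv⟩ := Set.not_subset.1 (hcon K)
    obtain ⟨x, hx, hx0⟩ := exists_window_eq v p q (hp.trans hq.symm) (Classical.arbitrary A)
    rw [hp, hvm] at hx
    rw [hvm] at hx0
    refine ⟨x, ?_, ?_⟩
    · rw [Set.mem_ofPred_eq, hx]
      exact hpq
    · rw [Set.mem_ofPred_eq, hx0]
      exact hv
  obtain ⟨x, hx⟩ := IsCompact.nonempty_iInter_of_sequence_nonempty_isCompact_isClosed F hFd hFn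
    (hFc 0).isCompact hFc
  rw [Set.mem_iInter] at hx
  refine (hx 0).2 (mem_langN_iff.2 ⟨x, fun i n => ?_, 0, rfl⟩)
  obtain ⟨K, hK⟩ : ∃ K : ℕ, -(K : ℤ) ≤ i ∧ i + n ≤ m + K := ⟨(-i).toNat + (i + n).toNat, by omega⟩
  obtain ⟨a, ha⟩ := Int.eq_ofNat_of_zero_le (show 0 ≤ i + K by omega)
  obtain ⟨b, hb⟩ := Int.eq_ofNat_of_zero_le (show 0 ≤ m + K - (i + n) by omega)
  refine hV _ (hx K).1 _ ⟨window x (-(K : ℤ)) a, window x (i + n) b, ?_⟩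
  rw [show m + 2 * K = a + n + b by omega, window_add _ _ (a + n), window_add _ _ a,
    show -(K : ℤ) + (a : ℕ) = i by omega, show -(K : ℤ) + (a + n : ℕ) = i + n by push_cast; omega]

lemma ncard_extN_add_le [Finite A] {V : Set (List A)} (hV : ∀ v ∈ V, ∀ u, u <:+: v → u ∈ V)
    (K N m : ℕ) : (extN V K (N + m)).ncard ≤ (extN V K N).ncard * (extN V K m).ncard := by
  rw [← Set.ncard_prod]
  refine Set.ncard_le_ncard_of_injOn (fun v => (v.take N, v.drop N)) ?_ ?_
    ((finite_extN V K N).prod (finite_extN V K m))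
  · rintro v ⟨hv, p, q, hp, hq, hpq⟩
    rw [Set.mem_prod]
    have hv1 : v.take N ++ (v.drop N ++ q) = v ++ q := by
      rw [← List.append_assoc, List.take_append_drop]
    have hv2 : p ++ v.take N ++ v.drop N = p ++ v := by
      rw [List.append_assoc, List.take_append_drop]
    refine ⟨⟨by simp [hv], p, (v.drop N ++ q).take K, hp, by simp [hv, hq], ?_⟩,
      ⟨by simp [hv], (p ++ v.take N).drop N, q, by simp [hv, hp], hq, ?_⟩⟩
    · refine hV _ hpq _ ⟨[], (v.drop N ++ q).drop K, ?_⟩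
      simp [hv1]
    · refine hV _ hpq _ ⟨(p ++ v.take N).take N, [], ?_⟩
      simp only [← List.append_assoc, List.take_append_drop, List.append_nil, hv2]
  · intro v _ v' _ h
    simp only [Prod.mk.injEq] at h
    rw [← List.take_append_drop N v, h.1, h.2, List.take_append_drop]

lemma ncard_setOf_length_add_le [Finite A] (V : Set (List A)) (K N : ℕ) :
    { v ∈ V | v.length = N + 2 * K }.ncard ≤
      (extN V K N).ncard * ({ v : List A | v.length = K } ×ˢ { v : List A | v.length = K }).ncard := by
  rw [← Set.ncard_prod]
  refine Set.ncard_le_ncard_of_injOn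
    (fun v => ((v.drop K).take N, (v.take K, (v.drop K).drop N))) ?_ ?_
    ((finite_extN V K N).prod ((List.finite_length_eq A K).prod (List.finite_length_eq A K)))
  · rintro v ⟨hvV, hv⟩
    refine ⟨⟨by simp [hv]; omega, v.take K, (v.drop K).drop N, by simp [hv]; omega,
      by simp [hv]; omega, ?_⟩, by simp [hv]; omega, by simp [hv]; omega⟩
    rwa [List.append_assoc, List.take_append_drop, List.take_append_drop]
  · intro v _ v' _ h
    simp only [Prod.mk.injEq] at h
    rw [← List.take_append_drop K v, ← List.take_append_drop N (v.drop K), h.1, h.2.1, h.2.2,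
      List.take_append_drop, List.take_append_drop]

end FactorialLanguages

/-- A nonnegative sequence contracted along steps of length `m` is summable. -/
lemma summable_of_add_le_mul {f : ℕ → ℝ} (hf : ∀ N, 0 ≤ f N) {m : ℕ} {r : ℝ}
    (hr : r < 1) (h : ∀ N, f (N + m) ≤ f N * r) : Summable f := by
  set B := ∑ N ∈ Finset.range m, f N
  refine summable_of_sum_range_le (c := B / (1 - r)) hf fun M => ?_
  rw [le_div_iff₀ (by linarith)]
  have h1 : ∑ N ∈ Finset.range M, f N ≤ ∑ N ∈ Finset.range (m + M), f N :=
    Finset.sum_le_sum_of_subset_of_nonneg (Finset.range_mono (by omega)) fun _ _ _ => hf _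
  have h2 : ∑ N ∈ Finset.range M, f (m + N) ≤ (∑ N ∈ Finset.range M, f N) * r := by
    rw [Finset.sum_mul]
    exact Finset.sum_le_sum fun N _ => by rw [add_comm]; exact h N
  rw [Finset.sum_range_add] at h1
  linarith

lemma one_le_ncard_langN_shiftOf_mul_pow {A : Type*} [Finite A] [Nonempty A] {V : Set (List A)}
    (hV : ∀ v ∈ V, ∀ u, u <:+: v → u ∈ V) {z : ℝ} (hz : 0 ≤ z)
    (hdiv : ¬ Summable fun N => ({ v ∈ V | v.length = N }.ncard : ℝ) * z ^ N) (m : ℕ) :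
    1 ≤ ((langN (shiftOf V) m).ncard : ℝ) * z ^ m := by
  by_contra! hlt
  obtain ⟨K, hK⟩ := exists_extN_subset_langN hV m
  apply hdiv
  have hs : Summable fun N => ((extN V K N).ncard : ℝ) * z ^ N := by
    refine summable_of_add_le_mul (fun N => by positivity) hlt (m := m) fun N => ?_
    have h1 : ((extN V K (N + m)).ncard : ℝ) ≤
        (extN V K N).ncard * (langN (shiftOf V) m).ncard := by
      exact_mod_cast (ncard_extN_add_le hV K N m).trans
        (Nat.mul_le_mul_left _ (Set.ncard_le_ncard hK (finite_langN _ _)))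
    calc ((extN V K (N + m)).ncard : ℝ) * z ^ (N + m)
        ≤ (extN V K N).ncard * (langN (shiftOf V) m).ncard * z ^ (N + m) := by gcongr
      _ = _ := by ring
  rw [← summable_nat_add_iff (2 * K)]
  refine Summable.of_nonneg_of_le (fun N => by positivity) (fun N => ?_) (hs.mul_right
    ((({ v : List A | v.length = K } ×ˢ { v : List A | v.length = K }).ncard : ℝ) * z ^ (2 * K)))
  have h1 : ({ v ∈ V | v.length = N + 2 * K }.ncard : ℝ) ≤ (extN V K N).ncard *
      ({ v : List A | v.length = K } ×ˢ { v : List A | v.length = K }).ncard := by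
    exact_mod_cast ncard_setOf_length_add_le V K N
  calc ({ v ∈ V | v.length = N + 2 * K }.ncard : ℝ) * z ^ (N + 2 * K)
      ≤ (extN V K N).ncard *
        ({ v : List A | v.length = K } ×ˢ { v : List A | v.length = K }).ncard *
          z ^ (N + 2 * K) := by gcongr
    _ = _ := by ring

section GapWords

/-- The word `1 0^{s₁} 1 0^{s₂} ⋯ 1 0^{sₘ}` coded by the list of gaps `s₁, …, sₘ`. -/
def gapWord (l : List ℕ) : List (Fin 2) := l.flatMap fun s => 1 :: List.replicate s 0

@[simp] lemma gapWord_nil : gapWord [] = [] := rfl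

@[simp] lemma gapWord_cons (s : ℕ) (l : List ℕ) :
    gapWord (s :: l) = 1 :: (List.replicate s 0 ++ gapWord l) := by
  simp [gapWord]

@[simp] lemma gapWord_append (l l' : List ℕ) : gapWord (l ++ l') = gapWord l ++ gapWord l' := by
  simp [gapWord]

lemma gapWord_head? (l : List ℕ) : (gapWord l).head? ≠ some 0 := by
  cases l <;> simp

lemma gapWord_eq_nil {l : List ℕ} : gapWord l = [] ↔ l = [] := by
  cases l <;> simp

lemma replicate_append_cancel {A : Type*} {c : A} {s t : ℕ} {a b : List A}
    (ha : a.head? ≠ some c) (hb : b.head? ≠ some c)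
    (h : List.replicate s c ++ a = List.replicate t c ++ b) : s = t ∧ a = b := by
  induction s generalizing t with
  | zero => cases t with
    | zero => simpa using h
    | succ t => simp [List.replicate_succ] at h; simp [h] at ha
  | succ s ih => cases t with
    | zero => simp [List.replicate_succ] at h; simp [← h] at hb
    | succ t =>
      simp only [List.replicate_succ, List.cons_append, List.cons.injEq, true_and] at h
      simpa using ih h

lemma gapWord_injective : Function.Injective gapWord := by
  intro l
  induction l with
  | nil => exact fun l' h => (gapWord_eq_nil.1 h.symm).symm
  | cons s l ih =>
    rintro (_ | ⟨t, l'⟩) h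
    · simp at h
    · simp only [gapWord_cons, List.cons.injEq, true_and] at h
      obtain ⟨h1, h2⟩ := replicate_append_cancel (gapWord_head? l) (gapWord_head? l') h
      rw [h1, ih h2]

/-- A gap word can be cut in front of each `1`. -/
lemma exists_of_gapWord_eq_append {l : List ℕ} {a c : List (Fin 2)}
    (h : gapWord l = a ++ 1 :: c) :
    ∃ l₁ l₂, l = l₁ ++ l₂ ∧ gapWord l₁ = a ∧ gapWord l₂ = 1 :: c := by
  induction l generalizing a with
  | nil => simp at h
  | cons t l ih =>
    rcases a with _ | ⟨x, a⟩
    · exact ⟨[], t :: l, rfl, rfl, h⟩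
    simp only [gapWord_cons, List.cons_append, List.cons.injEq] at h
    obtain ⟨rfl, h⟩ := h
    rcases List.append_eq_append_iff.1 h with ⟨d, rfl, hd⟩ | ⟨d, hd, hd'⟩
    · obtain ⟨l₁, l₂, rfl, rfl, h2⟩ := ih hd
      exact ⟨t :: l₁, l₂, rfl, by simp, h2⟩
    · rcases d with _ | ⟨y, d⟩
      · refine ⟨[t], l, rfl, ?_, by simpa using hd'.symm⟩
        simp only [List.append_nil] at hd
        simp [hd]
      · have hy : y ∈ List.replicate t (0 : Fin 2) := by simp [hd]
        simp only [List.cons_append, List.cons.injEq] at hd'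
        rw [← hd'.1] at hy
        simp at hy

lemma mem_of_infix_gapWord {l : List ℕ} {s : ℕ}
    (h : 1 :: (List.replicate s 0 ++ [1]) <:+: gapWord l) : s ∈ l := by
  obtain ⟨a, b, h⟩ := h
  have h' : gapWord l = a ++ 1 :: (List.replicate s 0 ++ 1 :: b) := by simp [← h]
  obtain ⟨l₁, l₂, rfl, -, h2⟩ := exists_of_gapWord_eq_append h'
  rcases l₂ with _ | ⟨t, l₂⟩
  · simp at h2
  · simp only [gapWord_cons, List.cons.injEq, true_and] at h2
    simp [(replicate_append_cancel (gapWord_head? l₂) (by simp) h2).1]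

lemma exists_le_of_replicate_infix_gapWord {l : List ℕ} {n : ℕ} (hn : 0 < n)
    (h : List.replicate n 0 <:+: gapWord l) : ∃ s ∈ l, n ≤ s := by
  obtain ⟨a, b, h⟩ := h
  induction l generalizing a with
  | nil => simp at h; omega
  | cons t l ih =>
    obtain ⟨k, rfl⟩ : ∃ k, n = k + 1 := ⟨n - 1, by omega⟩
    rcases a with _ | ⟨x, a⟩
    · simp [List.replicate_succ] at h
    simp only [gapWord_cons, List.cons_append, List.cons.injEq, List.append_assoc] at h
    rcases List.append_eq_append_iff.1 h.2.symm with ⟨d, -, hd⟩ | ⟨d, hd, hd'⟩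
    · obtain ⟨s, hs, hle⟩ := ih d (by simp [hd])
      exact ⟨s, by simp [hs], hle⟩
    · obtain ⟨-, hdr⟩ := List.append_eq_replicate_iff.1 hd.symm
      have hdl : d.length ≤ t := by
        have := congrArg List.length hd
        simp at this
        omega
      refine ⟨t, by simp, ?_⟩
      by_contra! hlt
      obtain ⟨j, hj⟩ : ∃ j, k + 1 = d.length + (j + 1) := ⟨k - d.length, by omega⟩
      rw [hj, hdr.2, List.length_replicate, List.replicate_add, List.append_assoc,
        List.append_cancel_left_eq] at hd'
      exact gapWord_head? l (by rw [← hd']; simp [List.replicate_succ])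

lemma replicate_infix_gapWord {l : List ℕ} {s : ℕ} (hs : s ∈ l) :
    List.replicate s 0 <:+: gapWord l := by
  obtain ⟨l₁, l₂, rfl⟩ := List.append_of_mem hs
  exact ⟨gapWord l₁ ++ [1], gapWord l₂, by simp⟩

/-- The lists of gaps in `S` whose word avoids `w`. -/
def avoidingGaps (S : Set ℕ) (w : List (Fin 2)) : Set (List ℕ) :=
  { l | (∀ s ∈ l, s ∈ S) ∧ ¬ w <:+: gapWord l }

/-- The words occurring in gap words with gaps in `S` avoiding `w`. -/
def avoidingWords (S : Set ℕ) (w : List (Fin 2)) : Set (List (Fin 2)) :=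
  { v | ∃ l ∈ avoidingGaps S w, v <:+: gapWord l }

lemma avoidingWords_factorial (S : Set ℕ) (w : List (Fin 2)) :
    ∀ v ∈ avoidingWords S w, ∀ u, u <:+: v → u ∈ avoidingWords S w :=
  fun _ ⟨l, hl, hv⟩ _ hu => ⟨l, hl, hu.trans hv⟩

lemma gapsIn_iff_window {S : Set ℕ} {x : ℤ → Fin 2} :
    gapsIn S x ↔ ∀ (i : ℤ) (s : ℕ),
      window x i (1 + (s + 1)) = 1 :: (List.replicate s 0 ++ [1]) → s ∈ S := by
  constructor
  · intro h i s hs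
    rw [window_add, window_add, window_one, window_one] at hs
    simp only [Nat.cast_one, List.singleton_append, List.cons.injEq] at hs
    obtain ⟨h1, h2⟩ := hs
    obtain ⟨h2, h3⟩ := List.append_inj h2 (by simp)
    simp only [List.cons.injEq, and_true] at h3
    have := h i (i + 1 + s) (by omega) h1 h3 fun k hk hk' => by
      have h2' : window x (i + 1) (List.replicate s (0 : Fin 2)).length = List.replicate s 0 := by
        simpa using h2
      rw [window_eq_iff] at h2'
      have := h2' ⟨(k - (i + 1)).toNat, by simp; omega⟩
      simp only [List.get_eq_getElem, List.getElem_replicate] at this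
      rwa [show i + 1 + ((k - (i + 1)).toNat : ℕ) = k by omega] at this
    rwa [show (i + 1 + s - i - 1).toNat = s by omega] at this
  · intro h i j hij hi hj hk
    obtain ⟨s, hs⟩ := Int.eq_ofNat_of_zero_le (show 0 ≤ j - i - 1 by omega)
    rw [hs]
    refine h i s ?_
    rw [window_add, window_add, window_one, window_one, hi, Nat.cast_one,
      show i + 1 + (s : ℤ) = j by omega, hj,
      window_eq_replicate fun k hks => hk (i + 1 + k) (by omega) (by omega)]
    rfl

lemma shiftOf_avoidingWords_subset (S : Set ℕ) (w : List (Fin 2)) :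
    shiftOf (avoidingWords S w) ⊆ perturb (SgapShift S) w := by
  intro x hx
  refine ⟨⟨gapsIn_iff_window.2 fun i s his => ?_, ?_⟩, fun ho => ?_⟩
  · obtain ⟨l, hl, hv⟩ := hx i (1 + (s + 1))
    exact hl.1 s (mem_of_infix_gapWord (his ▸ hv))
  · refine or_iff_not_imp_left.2 fun hfin => ?_
    obtain ⟨M, hM⟩ := (Set.not_infinite.1 hfin).bddAbove
    have key : ∀ i : ℤ, ∃ k : ℕ, k < M + 1 ∧ x (i + k) = 1 := by
      intro i
      by_contra! hcon
      obtain ⟨l, hl, hv⟩ := hx i (M + 1)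
      rw [window_eq_replicate (a := 0) fun k hk => by have := hcon k hk; omega] at hv
      obtain ⟨s, hs, hMs⟩ := exists_le_of_replicate_infix_gapWord (by omega) hv
      have := hM (hl.1 s hs)
      omega
    refine ⟨fun n => ?_, fun n => ?_⟩
    · obtain ⟨k, -, hk⟩ := key (n + 1)
      exact ⟨_, by omega, hk⟩
    · obtain ⟨k, hkM, hk⟩ := key (n - M - 1)
      exact ⟨_, by omega, hk⟩
  · obtain ⟨i, hi⟩ := occursIn_iff_window.1 ho
    obtain ⟨l, hl, hv⟩ := hx i w.length
    exact hl.2 (hi ▸ hv)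

end GapWords

section Counting

open scoped ENNReal

/-- If the word `w` can only be completed by a new gap in such a way that `w'` followed by `0`s
appears after an avoiding gap word, and the weight of the gaps exceeds `1` by at least the weight
of these completions, then the avoiding gap words have infinite weight. -/
lemma tsum_avoidingGaps_eq_top {S : Set ℕ} {w w' : List (Fin 2)} (hw : w ≠ [])
    (hcomp : ∀ l ∈ avoidingGaps S w, ∀ s ∈ S, w <:+: gapWord (l ++ [s]) →
      ∃ l' ∈ avoidingGaps S w, ∃ r, gapWord (l ++ [s]) = gapWord l' ++ w' ++ List.replicate r 0)
    {z : ℝ≥0∞} (hfin : z ^ w'.length * ∑' r : ℕ, z ^ r ≠ ⊤)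
    (hz : 1 + z ^ w'.length * ∑' r : ℕ, z ^ r ≤ ∑' s : S, z ^ ((s : ℕ) + 1)) :
    ∑' l : avoidingGaps S w, z ^ (gapWord l).length = ⊤ := by
  classical
  set T : ℝ≥0∞ := ∑' l : avoidingGaps S w, z ^ (gapWord l).length with hT
  set F : ℝ≥0∞ := z ^ w'.length * ∑' r : ℕ, z ^ r with hF
  let e : avoidingGaps S w := ⟨[], by simp [avoidingGaps, hw]⟩
  choose! c hc using hcomp
  have hmem : ∀ q : avoidingGaps S w × S, ¬ w <:+: gapWord (q.1 ++ [(q.2 : ℕ)]) →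
      (q.1 : List ℕ) ++ [(q.2 : ℕ)] ∈ avoidingGaps S w := by
    rintro ⟨⟨l, hl⟩, ⟨s, hs⟩⟩ hq
    refine ⟨fun t ht => ?_, hq⟩
    rcases List.mem_append.1 ht with h | h
    · exact hl.1 t h
    · simp only [List.mem_singleton] at h
      exact h ▸ hs
  have hc' : ∀ q : avoidingGaps S w × S, w <:+: gapWord (q.1 ++ [(q.2 : ℕ)]) →
      c q.1 q.2 ∈ avoidingGaps S w ∧ ∃ r, gapWord (q.1 ++ [(q.2 : ℕ)]) =
        gapWord (c q.1 q.2) ++ w' ++ List.replicate r 0 :=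
    fun q hq => hc q.1 q.1.2 q.2 q.2.2 hq
  let Φ : Unit ⊕ (avoidingGaps S w × S) → avoidingGaps S w ⊕ (avoidingGaps S w × ℕ)
    | Sum.inl _ => Sum.inl e
    | Sum.inr q => if h : w <:+: gapWord (q.1 ++ [(q.2 : ℕ)]) then
        Sum.inr (⟨c q.1 q.2, (hc' q h).1⟩, (hc' q h).2.choose)
      else Sum.inl ⟨_, hmem q h⟩
  let g : avoidingGaps S w ⊕ (avoidingGaps S w × ℕ) → List (Fin 2) :=
    Sum.elim (fun l => gapWord l) fun q => gapWord q.1 ++ w' ++ List.replicate q.2 0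
  have hg : ∀ q : avoidingGaps S w × S, g (Φ (Sum.inr q)) = gapWord (q.1 ++ [(q.2 : ℕ)]) := by
    intro q
    by_cases h : w <:+: gapWord (q.1 ++ [(q.2 : ℕ)])
    · simp only [Φ, h, dif_pos, g, Sum.elim_inr]
      exact (hc' q h).2.choose_spec.symm
    · simp only [Φ, h, g]
      simp
  have hinj : Function.Injective Φ := by
    have hg' : Function.Injective fun o => g (Φ o) := by
      rintro (_ | q) (_ | q') h
      · rfl
      · replace h : gapWord e = g (Φ (Sum.inr q')) := h
        rw [hg] at h
        have := gapWord_injective h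
        simp [e] at this
      · replace h : g (Φ (Sum.inr q)) = gapWord e := h
        rw [hg] at h
        have := gapWord_injective h
        simp [e] at this
      · replace h : g (Φ (Sum.inr q)) = g (Φ (Sum.inr q')) := h
        rw [hg, hg] at h
        have := List.append_inj' (gapWord_injective h) rfl
        simp only [List.cons.injEq, and_true] at this
        rw [Prod.ext (Subtype.ext this.1) (Subtype.ext this.2)]
    exact hg'.of_comp
  have key := ENNReal.tsum_comp_le_tsum_of_injective hinj fun y => z ^ (g y).length
  have hl : ∑' o, z ^ (g (Φ o)).length = 1 + T * ∑' s : S, z ^ ((s : ℕ) + 1) := by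
    rw [Summable.tsum_sum ENNReal.summable ENNReal.summable, tsum_fintype,
      Fintype.sum_unique]
    congr 1
    · change z ^ (gapWord []).length = 1
      simp
    · simp_rw [hg]
      rw [ENNReal.tsum_prod', hT, ← ENNReal.tsum_mul_right]
      refine tsum_congr fun l => ?_
      rw [← ENNReal.tsum_mul_left]
      refine tsum_congr fun s => ?_
      simp [pow_add]
  have hr : ∑' y, z ^ (g y).length = T + T * F := by
    rw [Summable.tsum_sum ENNReal.summable ENNReal.summable]
    congr 1
    rw [ENNReal.tsum_prod', hT, ← ENNReal.tsum_mul_right]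
    refine tsum_congr fun l => ?_
    rw [hF, ← mul_assoc, ← ENNReal.tsum_mul_left]
    refine tsum_congr fun s => ?_
    simp [g, pow_add, mul_assoc]
  rw [hl, hr] at key
  by_contra hne
  have h1 : 1 + (T + T * F) ≤ 0 + (T + T * F) := by
    rw [zero_add]
    refine le_trans ?_ key
    gcongr
    calc T + T * F = T * (1 + F) := by ring
      _ ≤ _ := by gcongr
  have h2 := (ENNReal.add_le_add_iff_right
    (ENNReal.add_ne_top.2 ⟨hne, ENNReal.mul_ne_top hne hfin⟩)).1 h1
  simp at h2

/-- Divergence over avoiding gap words gives divergence over the words they contain. -/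
lemma not_summable_avoidingWords {S : Set ℕ} {w : List (Fin 2)} {z : ℝ} (hz : 0 ≤ z)
    (htop : ∑' l : avoidingGaps S w, ENNReal.ofReal z ^ (gapWord l).length = ⊤) :
    ¬ Summable fun N => ({ v ∈ avoidingWords S w | v.length = N }.ncard : ℝ) * z ^ N := by
  intro hsum
  have hle : ∑' l : avoidingGaps S w, ENNReal.ofReal z ^ (gapWord l).length ≤
      ∑' N, ENNReal.ofReal (({ v ∈ avoidingWords S w | v.length = N }.ncard : ℝ) * z ^ N) := by
    rw [← ENNReal.tsum_fiberwise _ fun l : avoidingGaps S w => (gapWord l).length]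
    refine ENNReal.tsum_le_tsum fun N => ?_
    have hNfin : { v ∈ avoidingWords S w | v.length = N }.Finite :=
      (List.finite_length_eq (Fin 2) N).subset fun _ h => h.2
    have hcard : ENat.card ((fun l : avoidingGaps S w => (gapWord l).length) ⁻¹' {N}) ≤
        { v ∈ avoidingWords S w | v.length = N }.ncard := by
      rw [hNfin.cast_ncard_eq]
      refine ENat.card_le_card_of_injective
        (f := fun l => ⟨gapWord l.1, ⟨l.1, l.1.2, List.infix_rfl⟩, l.2⟩) fun l l' h => ?_
      simp only [Subtype.mk.injEq] at h
      exact Subtype.ext (Subtype.ext (gapWord_injective h))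
    calc ∑' l : (fun l : avoidingGaps S w => (gapWord l).length) ⁻¹' {N},
          ENNReal.ofReal z ^ (gapWord l.1).length
        = ∑' _ : (fun l : avoidingGaps S w => (gapWord l).length) ⁻¹' {N},
          ENNReal.ofReal z ^ N := tsum_congr fun l => by
            rw [show (gapWord l.1).length = N from l.2]
      _ = ENat.card ((fun l : avoidingGaps S w => (gapWord l).length) ⁻¹' {N}) *
          ENNReal.ofReal z ^ N := ENNReal.tsum_const _
      _ ≤ ({ v ∈ avoidingWords S w | v.length = N }.ncard : ℝ≥0∞) * ENNReal.ofReal z ^ N := by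
          gcongr
          exact_mod_cast ENat.toENNReal_le.2 hcard
      _ = _ := by
          rw [ENNReal.ofReal_mul (by positivity), ENNReal.ofReal_natCast, ENNReal.ofReal_pow hz]
  rw [htop, top_le_iff] at hle
  exact hsum.tsum_ofReal_ne_top hle

end Counting

section Completions

lemma exists_completion_of_cons_one (S : Set ℕ) (u : List (Fin 2)) :
    ∀ l ∈ avoidingGaps S (1 :: u), ∀ s ∈ S, 1 :: u <:+: gapWord (l ++ [s]) →
      ∃ l' ∈ avoidingGaps S (1 :: u), ∃ r,
        gapWord (l ++ [s]) = gapWord l' ++ (1 :: u) ++ List.replicate r 0 := by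
  rintro l hl s - ⟨a, b, h⟩
  obtain ⟨l₁, l₂, hl12, rfl, h2⟩ := exists_of_gapWord_eq_append
    (show gapWord (l ++ [s]) = a ++ 1 :: (u ++ b) by simp [← h])
  obtain ⟨l₃, rfl⟩ : l₁ <+: l := by
    rcases List.eq_nil_or_concat l₂ with rfl | ⟨l₃, t, rfl⟩
    · simp at h2
    · rw [List.concat_eq_append, ← List.append_assoc] at hl12
      exact ⟨l₃, (List.append_inj' hl12 rfl).1.symm⟩
  refine ⟨l₁, ⟨fun t ht => hl.1 t (List.mem_append_left _ ht), fun hi => hl.2 ?_⟩, b.length, ?_⟩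
  · rw [gapWord_append]
    exact hi.trans (List.prefix_append _ _).isInfix
  · rw [← h]
    congr 1
    have h' : (gapWord (l₁ ++ l₃) ++ [1]) ++ List.replicate s 0 = (gapWord l₁ ++ 1 :: u) ++ b := by
      rw [h, gapWord_append _ [s]]
      simp
    rcases List.append_eq_append_iff.1 h' with ⟨d, -, hd⟩ | ⟨d, hd, hd'⟩
    · exact (List.append_eq_replicate_iff.1 hd.symm).2.2
    · rcases List.eq_nil_or_concat d with rfl | ⟨d, x, rfl⟩
      · rw [hd', List.nil_append, List.length_replicate]
      · rw [List.concat_eq_append, ← List.append_assoc] at hd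
        refine absurd ?_ hl.2
        rw [(List.append_inj' hd rfl).1]
        exact ⟨gapWord l₁, d, rfl⟩

lemma exists_completion_of_replicate (S : Set ℕ) {n : ℕ} (hn : 0 < n) :
    ∀ l ∈ avoidingGaps S (List.replicate n 0), ∀ s ∈ S,
      List.replicate n 0 <:+: gapWord (l ++ [s]) →
      ∃ l' ∈ avoidingGaps S (List.replicate n 0), ∃ r,
        gapWord (l ++ [s]) = gapWord l' ++ (1 :: List.replicate n 0) ++ List.replicate r 0 := by
  intro l hl s _ h
  obtain ⟨t, ht, hnt⟩ := exists_le_of_replicate_infix_gapWord hn h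
  obtain ⟨j, rfl⟩ := Nat.exists_eq_add_of_le hnt
  rcases List.mem_append.1 ht with h' | h'
  · refine absurd ?_ hl.2
    refine List.IsInfix.trans ?_ (replicate_infix_gapWord h')
    exact ⟨[], List.replicate j 0, by simp⟩
  · simp only [List.mem_singleton] at h'
    exact ⟨l, hl, j, by simp [← h']⟩

end Completions

section Reversal

lemma reverse_window {A : Type*} (x : ℤ → A) (i : ℤ) (n : ℕ) :
    (window x i n).reverse = window (fun j => x (-j)) (-(i + n) + 1) n := by
  refine List.ext_getElem (by simp) fun k h1 h2 => ?_
  simp only [window, List.getElem_reverse, List.getElem_ofFn, List.length_ofFn]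
  simp only [length_window] at h2
  congr 1
  omega

lemma reflect_mem_SgapShift {S : Set ℕ} {x : ℤ → Fin 2} (hx : x ∈ SgapShift S) :
    (fun j => x (-j)) ∈ SgapShift S := by
  refine ⟨fun i j hij hi hj hk => ?_, hx.2.imp_right fun ⟨h1, h2⟩ => ⟨fun n => ?_, fun n => ?_⟩⟩
  · have := hx.1 (-j) (-i) (by omega) hj hi fun k h1 h2 => by
      simpa using hk (-k) (by omega) (by omega)
    rwa [show -i - -j - 1 = j - i - 1 by ring] at this
  · obtain ⟨i, hi, hxi⟩ := h2 (-n)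
    exact ⟨-i, by omega, by simpa using hxi⟩
  · obtain ⟨i, hi, hxi⟩ := h1 (-n)
    exact ⟨-i, by omega, by simpa using hxi⟩

lemma ncard_langN_perturb_reverse_le (S : Set ℕ) (w : List (Fin 2)) (n : ℕ) :
    (langN (perturb (SgapShift S) w.reverse) n).ncard ≤
      (langN (perturb (SgapShift S) w) n).ncard := by
  refine Set.ncard_le_ncard_of_injOn List.reverse (fun v hv => ?_)
    List.reverse_injective.injOn (finite_langN _ _)
  obtain ⟨x, hx, i, rfl⟩ := mem_langN_iff.1 hv
  refine mem_langN_iff.2 ⟨fun j => x (-j), ⟨reflect_mem_SgapShift hx.1, fun ho => hx.2 ?_⟩, _,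
    (reverse_window x i n).symm⟩
  obtain ⟨j, hj⟩ := occursIn_iff_window.1 ho
  rw [occursIn_iff_window]
  refine ⟨-(j + w.length) + 1, ?_⟩
  conv_rhs => rw [← hj]
  rw [reverse_window]
  simp

end Reversal

section UpperBound

open scoped Classical

/-- The words of length `N` starting with `1` all of whose inner gaps lie in `S`. -/
def gapBlocks (S : Set ℕ) (N : ℕ) : Set (List (Fin 2)) :=
  { v | v.length = N ∧ v.head? = some 1 ∧ ∀ s, 1 :: (List.replicate s 0 ++ [1]) <:+: v → s ∈ S }

lemma exists_eq_replicate_append (v : List (Fin 2)) :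
    ∃ k v', v = List.replicate k 0 ++ v' ∧ (v' = [] ∨ v'.head? = some 1) := by
  induction v with
  | nil => exact ⟨0, [], by simp⟩
  | cons x v ih =>
    by_cases hx : x = 0
    · obtain ⟨k, v', rfl, h⟩ := ih
      exact ⟨k + 1, v', by simp [hx, List.replicate_succ], h⟩
    · exact ⟨0, x :: v, by simp, by simp; omega⟩

lemma gapBlocks_subset (S : Set ℕ) (N : ℕ) :
    gapBlocks S (N + 1) ⊆ {1 :: List.replicate N 0} ∪
      ⋃ s ∈ (Finset.range N).filter (· ∈ S),
        (fun v => 1 :: (List.replicate s 0 ++ v)) '' gapBlocks S (N - s) := by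
  rintro (_ | ⟨x, v⟩) ⟨hl, hh, hS⟩
  · simp at hl
  obtain rfl : x = 1 := by simpa using hh
  obtain ⟨k, v', rfl, rfl | hv'⟩ := exists_eq_replicate_append v
  · left
    simp only [List.append_nil, List.length_cons, List.length_replicate] at hl
    simp [show k = N by omega]
  · right
    obtain ⟨v'', rfl⟩ : ∃ v'', v' = 1 :: v'' := by
      rcases v' with _ | ⟨y, v''⟩
      · simp at hv'
      · exact ⟨v'', by simpa using hv'⟩
    simp only [List.length_cons, List.length_append, List.length_replicate] at hl
    have hk : k ∈ S := hS k ⟨[], v'', by simp⟩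
    simp only [Set.mem_iUnion]
    refine ⟨k, by simp [hk]; omega, 1 :: v'', ⟨by simp; omega, by simp, fun s hs => hS s ?_⟩, rfl⟩
    exact hs.trans ⟨1 :: List.replicate k 0, [], by simp⟩

lemma finite_gapBlocks (S : Set ℕ) (N : ℕ) : (gapBlocks S N).Finite :=
  (List.finite_length_eq (Fin 2) N).subset fun _ h => h.1

lemma ncard_gapBlocks_le {S : Set ℕ} {lam : ℝ} (hlam : 1 ≤ lam)
    (hsum : ∀ N, ∑ s ∈ (Finset.range N).filter (· ∈ S), (lam ^ (s + 1))⁻¹ ≤ 1) (N : ℕ) :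
    ((gapBlocks S N).ncard : ℝ) ≤ N * lam ^ N := by
  induction N using Nat.strong_induction_on with
  | _ N ih =>
    rcases N with _ | N
    · have : gapBlocks S 0 = ∅ := by
        refine Set.eq_empty_of_forall_notMem fun v hv => ?_
        have h1 := List.length_eq_zero_iff.1 hv.1
        have h2 := hv.2.1
        simp [h1] at h2
      simp [this]
    · have h1 : (gapBlocks S (N + 1)).ncard ≤
          1 + ∑ s ∈ (Finset.range N).filter (· ∈ S), (gapBlocks S (N - s)).ncard := by
        refine (Set.ncard_le_ncard (gapBlocks_subset S N) ?_).trans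
          ((Set.ncard_union_le _ _).trans (add_le_add (by simp)
            ((Finset.set_ncard_biUnion_le _ _).trans
              (Finset.sum_le_sum fun s _ => Set.ncard_image_le (finite_gapBlocks _ _)))))
        exact (Set.finite_singleton _).union
          (Set.Finite.biUnion (Finset.finite_toSet _) fun s _ => (finite_gapBlocks _ _).image _)
      have h2 : ∀ s ∈ (Finset.range N).filter (· ∈ S), ((gapBlocks S (N - s)).ncard : ℝ) ≤
          N * lam ^ (N + 1) * (lam ^ (s + 1))⁻¹ := by
        intro s hs
        have hsN : s < N := by simpa using (Finset.mem_filter.1 hs).1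
        have hpos : 0 < lam ^ (s + 1) := by positivity
        calc ((gapBlocks S (N - s)).ncard : ℝ) ≤ (N - s : ℕ) * lam ^ (N - s) := ih _ (by omega)
          _ ≤ N * lam ^ (N - s) := by gcongr; omega
          _ = N * lam ^ (N + 1) * (lam ^ (s + 1))⁻¹ := by
            rw [show N + 1 = (N - s) + (s + 1) by omega, pow_add]
            field_simp
      have h3 : ((gapBlocks S (N + 1)).ncard : ℝ) ≤
          1 + ∑ s ∈ (Finset.range N).filter (· ∈ S), ((gapBlocks S (N - s)).ncard : ℝ) := by
        exact_mod_cast h1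
      have h4 := Finset.sum_le_sum h2
      rw [← Finset.mul_sum] at h4
      have h5 : N * lam ^ (N + 1) *
          ∑ s ∈ (Finset.range N).filter (· ∈ S), (lam ^ (s + 1))⁻¹ ≤ N * lam ^ (N + 1) :=
        mul_le_of_le_one_right (by positivity) (hsum N)
      have h6 : 1 ≤ lam ^ (N + 1) := one_le_pow₀ hlam
      push_cast
      linarith

lemma langN_SgapShift_subset (S : Set ℕ) (N : ℕ) :
    langN (SgapShift S) N ⊆ {List.replicate N 0} ∪
      ⋃ k ∈ Finset.range N, (fun v => List.replicate k 0 ++ v) '' gapBlocks S (N - k) := by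
  intro v hv
  obtain ⟨x, hx, i, rfl⟩ := mem_langN_iff.1 hv
  have hS : ∀ s, 1 :: (List.replicate s 0 ++ [1]) <:+: window x i N → s ∈ S := by
    rintro s ⟨a, b, h⟩
    refine gapsIn_iff_window.1 hx.1 (i + a.length) s ?_
    have hN : N = a.length + ((1 + (s + 1)) + b.length) := by
      have := congrArg List.length h
      simp at this
      omega
    rw [hN, window_add, window_add, List.append_assoc] at h
    exact (List.append_inj (List.append_inj h (by simp)).2 (by simp; omega)).1.symm
  have hl := length_window x i N
  obtain ⟨k, v', hv', rfl | hh⟩ := exists_eq_replicate_append (window x i N)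
  · left
    rw [hv'] at hl ⊢
    simp only [List.append_nil, List.length_replicate] at hl
    simp [hl]
  · right
    rw [hv'] at hl hS ⊢
    have hpos : 0 < v'.length := List.length_pos_iff.2 (by rintro rfl; simp at hh)
    simp only [List.length_append, List.length_replicate] at hl
    simp only [Set.mem_iUnion]
    exact ⟨k, by simp; omega, v', ⟨by omega, hh,
      fun s hs => hS s (hs.trans (List.suffix_append _ _).isInfix)⟩, rfl⟩

lemma ncard_langN_SgapShift_le {S : Set ℕ} {lam : ℝ} (hlam : 1 ≤ lam)
    (hsum : ∀ N, ∑ s ∈ (Finset.range N).filter (· ∈ S), (lam ^ (s + 1))⁻¹ ≤ 1) (N : ℕ) :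
    ((langN (SgapShift S) N).ncard : ℝ) ≤ ((N : ℝ) + 1) ^ 2 * lam ^ N := by
  have h1 : (langN (SgapShift S) N).ncard ≤
      1 + ∑ k ∈ Finset.range N, (gapBlocks S (N - k)).ncard := by
    refine (Set.ncard_le_ncard (langN_SgapShift_subset S N) ?_).trans
      ((Set.ncard_union_le _ _).trans (add_le_add (by simp)
        ((Finset.set_ncard_biUnion_le _ _).trans
          (Finset.sum_le_sum fun s _ => Set.ncard_image_le (finite_gapBlocks _ _)))))
    exact (Set.finite_singleton _).union
      (Set.Finite.biUnion (Finset.finite_toSet _) fun s _ => (finite_gapBlocks _ _).image _)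
  have h2 : ∀ k ∈ Finset.range N, ((gapBlocks S (N - k)).ncard : ℝ) ≤ N * lam ^ N := by
    intro k _
    refine (ncard_gapBlocks_le hlam hsum (N - k)).trans ?_
    gcongr <;> first | exact hlam | omega
  have h3 : ((langN (SgapShift S) N).ncard : ℝ) ≤
      1 + ∑ k ∈ Finset.range N, ((gapBlocks S (N - k)).ncard : ℝ) := by
    exact_mod_cast h1
  have h4 := Finset.sum_le_sum h2
  rw [Finset.sum_const, Finset.card_range, nsmul_eq_mul] at h4
  have h5 : 1 ≤ lam ^ N := one_le_pow₀ hlam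
  have h6 : 0 ≤ (N : ℝ) * lam ^ N := by positivity
  nlinarith

end UpperBound

section Entropy

open scoped Classical

lemma tendsto_log_bound (lam : ℝ) :
    Tendsto (fun N : ℕ => 2 * (Real.log ((N : ℝ) + 1) / N) + Real.log lam) atTop
      (𝓝 (Real.log lam)) := by
  have h1 := Real.tendsto_pow_log_div_mul_add_atTop 1 (-1) 1 one_ne_zero
  have h2 : Tendsto (fun N : ℕ => (N : ℝ) + 1) atTop atTop :=
    tendsto_atTop_add_const_right _ _ tendsto_natCast_atTop_atTop
  have h3 := ((h1.comp h2).const_mul 2).add_const (Real.log lam)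
  simpa [Function.comp_def] using h3

lemma log_ncard_div_nonneg {X : Set (ℤ → Fin 2)} (N : ℕ) :
    0 ≤ Real.log ((langN X N).ncard) / N :=
  div_nonneg (Real.log_natCast_nonneg _) (Nat.cast_nonneg _)

lemma isCoboundedUnder_entropy (X : Set (ℤ → Fin 2)) :
    IsCoboundedUnder (· ≤ ·) atTop fun N : ℕ => Real.log ((langN X N).ncard) / N :=
  (isBoundedUnder_of ⟨0, fun N => log_ncard_div_nonneg N⟩ :
    IsBoundedUnder (· ≥ ·) atTop _).isCoboundedUnder_le

variable {S : Set ℕ} {lam : ℝ}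

lemma log_ncard_langN_div_le {X : Set (ℤ → Fin 2)} (hX : X ⊆ SgapShift S) (hlam : 1 ≤ lam)
    (hsum : ∀ N, ∑ s ∈ (Finset.range N).filter (· ∈ S), (lam ^ (s + 1))⁻¹ ≤ 1)
    {N : ℕ} (hN : 0 < N) :
    Real.log ((langN X N).ncard) / N ≤ 2 * (Real.log ((N : ℝ) + 1) / N) + Real.log lam := by
  have hNpos : (0 : ℝ) < N := by exact_mod_cast hN
  have h1 : ((langN X N).ncard : ℝ) ≤ ((N : ℝ) + 1) ^ 2 * lam ^ N :=
    le_trans (by exact_mod_cast ncard_langN_mono hX N) (ncard_langN_SgapShift_le hlam hsum N)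
  have h2 : Real.log ((langN X N).ncard) ≤ 2 * Real.log ((N : ℝ) + 1) + N * Real.log lam := by
    have h3 : Real.log (((N : ℝ) + 1) ^ 2 * lam ^ N) =
        2 * Real.log ((N : ℝ) + 1) + N * Real.log lam := by
      rw [Real.log_mul (by positivity) (by positivity), Real.log_pow, Real.log_pow]
      push_cast
      ring
    rw [← h3]
    rcases Nat.eq_zero_or_pos (langN X N).ncard with h0 | h0
    · rw [h0, Nat.cast_zero, Real.log_zero]
      exact Real.log_nonneg (one_le_mul_of_one_le_of_one_le
        (one_le_pow₀ (by linarith)) (one_le_pow₀ hlam))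
    · exact Real.log_le_log (by exact_mod_cast h0) h1
  rw [div_le_iff₀ hNpos]
  field_simp
  linarith

lemma isBoundedUnder_entropy {X : Set (ℤ → Fin 2)} (hX : X ⊆ SgapShift S) (hlam : 1 ≤ lam)
    (hsum : ∀ N, ∑ s ∈ (Finset.range N).filter (· ∈ S), (lam ^ (s + 1))⁻¹ ≤ 1) :
    IsBoundedUnder (· ≤ ·) atTop fun N : ℕ => Real.log ((langN X N).ncard) / N :=
  (tendsto_log_bound lam).isBoundedUnder_le.mono_le
    ((eventually_gt_atTop 0).mono fun _ hN => log_ncard_langN_div_le hX hlam hsum hN)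

lemma entropy_SgapShift_le (hlam : 1 ≤ lam)
    (hsum : ∀ N, ∑ s ∈ (Finset.range N).filter (· ∈ S), (lam ^ (s + 1))⁻¹ ≤ 1) :
    entropy (SgapShift S) ≤ Real.log lam := by
  rw [← (tendsto_log_bound lam).limsup_eq]
  exact limsup_le_limsup
    ((eventually_gt_atTop 0).mono fun _ hN => log_ncard_langN_div_le subset_rfl hlam hsum hN)
    (isCoboundedUnder_entropy _) (tendsto_log_bound lam).isBoundedUnder_le

lemma entropy_mono {X : Set (ℤ → Fin 2)} (hX : X ⊆ SgapShift S) (hlam : 1 ≤ lam)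
    (hsum : ∀ N, ∑ s ∈ (Finset.range N).filter (· ∈ S), (lam ^ (s + 1))⁻¹ ≤ 1) :
    entropy X ≤ entropy (SgapShift S) := by
  refine limsup_le_limsup (Eventually.of_forall fun N => ?_) (isCoboundedUnder_entropy _)
    (isBoundedUnder_entropy subset_rfl hlam hsum)
  have hle := ncard_langN_mono hX N
  dsimp only
  rcases Nat.eq_zero_or_pos (langN X N).ncard with h0 | h0
  · rw [h0, Nat.cast_zero, Real.log_zero, zero_div]
    exact log_ncard_div_nonneg N
  · have : (0 : ℝ) < (langN X N).ncard := by exact_mod_cast h0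
    gcongr

lemma le_entropy {X : Set (ℤ → Fin 2)} (hX : X ⊆ SgapShift S) (hlam : 1 ≤ lam)
    (hsum : ∀ N, ∑ s ∈ (Finset.range N).filter (· ∈ S), (lam ^ (s + 1))⁻¹ ≤ 1)
    {c : ℝ} (h : ∀ N : ℕ, 0 < N → c ≤ Real.log ((langN X N).ncard) / N) : c ≤ entropy X :=
  le_limsup_of_frequently_le ((eventually_gt_atTop 0).mono h).frequently
    (isBoundedUnder_entropy hX hlam hsum)

end Entropy

lemma one_le_ncard_langN_perturb_of_completion {S : Set ℕ} {w w' : List (Fin 2)} (hw : w ≠ [])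
    (hcomp : ∀ l ∈ avoidingGaps S w, ∀ s ∈ S, w <:+: gapWord (l ++ [s]) →
      ∃ l' ∈ avoidingGaps S w, ∃ r, gapWord (l ++ [s]) = gapWord l' ++ w' ++ List.replicate r 0)
    (hlen : w.length ≤ w'.length) {z δ : ℝ} (hz0 : 0 < z) (hz1 : z < 1)
    (hδ : z ^ w.length / (1 - z) ≤ δ)
    (hsum : 1 + ENNReal.ofReal δ ≤ ∑' s : S, ENNReal.ofReal z ^ ((s : ℕ) + 1)) (m : ℕ) :
    1 ≤ ((langN (perturb (SgapShift S) w) m).ncard : ℝ) * z ^ m := by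
  have hgeom : ENNReal.ofReal z ^ w'.length * ∑' r : ℕ, ENNReal.ofReal z ^ r ≤
      ENNReal.ofReal δ := by
    rw [ENNReal.tsum_geometric, ← ENNReal.ofReal_one, ← ENNReal.ofReal_sub _ hz0.le,
      ← ENNReal.ofReal_inv_of_pos (by linarith), ← ENNReal.ofReal_pow hz0.le,
      ← ENNReal.ofReal_mul (by positivity), ← div_eq_mul_inv]
    refine ENNReal.ofReal_le_ofReal (le_trans ?_ hδ)
    have : 0 < 1 - z := by linarith
    exact div_le_div_of_nonneg_right (pow_le_pow_of_le_one hz0.le hz1.le hlen) this.le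
  have htop := tsum_avoidingGaps_eq_top hw hcomp (ne_top_of_le_ne_top ENNReal.ofReal_ne_top hgeom)
    ((add_le_add_right hgeom 1).trans hsum)
  refine (one_le_ncard_langN_shiftOf_mul_pow (avoidingWords_factorial S w) hz0.le
    (not_summable_avoidingWords hz0.le htop) m).trans ?_
  refine mul_le_mul_of_nonneg_right ?_ (by positivity)
  exact_mod_cast ncard_langN_mono (shiftOf_avoidingWords_subset S w) m

lemma one_le_ncard_langN_perturb {S : Set ℕ} {w : List (Fin 2)} (hw : w ≠ [])
    (hform : ¬ ∃ u : List (Fin 2), (1 : Fin 2) ∈ u ∧ w = 0 :: (u ++ [0]))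
    {z δ : ℝ} (hz0 : 0 < z) (hz1 : z < 1) (hδ : z ^ w.length / (1 - z) ≤ δ)
    (hsum : 1 + ENNReal.ofReal δ ≤ ∑' s : S, ENNReal.ofReal z ^ ((s : ℕ) + 1)) (m : ℕ) :
    1 ≤ ((langN (perturb (SgapShift S) w) m).ncard : ℝ) * z ^ m := by
  have fin_cases_two : ∀ x : Fin 2, x = 0 ∨ x = 1 := by decide
  have hzero : ∀ {w : List (Fin 2)}, w ≠ [] → (1 : Fin 2) ∉ w → z ^ w.length / (1 - z) ≤ δ →
      1 ≤ ((langN (perturb (SgapShift S) w) m).ncard : ℝ) * z ^ m := by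
    intro w hw h1 hδ
    have hrep : w = List.replicate w.length 0 := List.eq_replicate_of_mem fun x hx =>
      (fin_cases_two x).resolve_right fun h => h1 (h ▸ hx)
    have hpos := List.length_pos_iff.2 hw
    generalize w.length = n at hrep hpos hδ
    subst hrep
    exact one_le_ncard_langN_perturb_of_completion hw (exists_completion_of_replicate S hpos)
      (by simp) hz0 hz1 (by simpa using hδ) hsum m
  rcases w with _ | ⟨x, u⟩
  · exact absurd rfl hw
  rcases fin_cases_two x with rfl | rfl
  · rcases List.eq_nil_or_concat u with rfl | ⟨u, y, rfl⟩
    · exact hzero hw (by simp) hδ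
    rw [List.concat_eq_append] at *
    rcases fin_cases_two y with rfl | rfl
    · exact hzero hw (fun h => hform ⟨u, by simpa using h, rfl⟩) hδ
    · have h := one_le_ncard_langN_perturb_of_completion (by simp)
        (exists_completion_of_cons_one S (u.reverse ++ [0])) le_rfl hz0 hz1 (by simpa using hδ)
        hsum m
      refine h.trans ?_
      refine mul_le_mul_of_nonneg_right ?_ (by positivity)
      have := ncard_langN_perturb_reverse_le S (0 :: (u ++ [1])) m
      simpa using this
  · exact one_le_ncard_langN_perturb_of_completion hw (exists_completion_of_cons_one S u) le_rfl
      hz0 hz1 hδ hsum m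

lemma summable_of_TR_eq_one {S : Set ℕ} {lam : ℝ} (h : TR S lam = 1) :
    Summable fun s : S => (lam ^ ((s : ℕ) + 1))⁻¹ := by
  by_contra hns
  rw [TR, tsum_eq_zero_of_not_summable hns] at h
  exact zero_ne_one h

open scoped Classical in
lemma sum_inv_pow_le_one {S : Set ℕ} {lam : ℝ} (hlam : 1 ≤ lam) (h : TR S lam = 1) (N : ℕ) :
    ∑ s ∈ (Finset.range N).filter (· ∈ S), (lam ^ (s + 1))⁻¹ ≤ 1 := by
  rw [← Finset.sum_subtype_eq_sum_filter, ← h]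
  have hsum := summable_of_TR_eq_one h
  exact hsum.sum_le_tsum _ fun s _ => by positivity

/-- The weight of the gaps grows at least linearly when the parameter leaves `lam⁻¹`. -/
lemma one_add_le_tsum_gaps {S : Set ℕ} {lam δ : ℝ} (hlam : 1 ≤ lam) (h : TR S lam = 1)
    (hδ : 0 ≤ δ) :
    1 + ENNReal.ofReal δ ≤
      ∑' s : S, ENNReal.ofReal (lam⁻¹ * Real.exp δ) ^ ((s : ℕ) + 1) := by
  have hone : ∑' s : S, ENNReal.ofReal ((lam ^ ((s : ℕ) + 1))⁻¹) = 1 := by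
    rw [← ENNReal.ofReal_tsum_of_nonneg (fun s => by positivity) (summable_of_TR_eq_one h)]
    change ENNReal.ofReal (TR S lam) = 1
    rw [h, ENNReal.ofReal_one]
  calc 1 + ENNReal.ofReal δ
      = ∑' s : S, ENNReal.ofReal (1 + δ) * ENNReal.ofReal ((lam ^ ((s : ℕ) + 1))⁻¹) := by
        rw [ENNReal.tsum_mul_left, hone, mul_one, ENNReal.ofReal_add zero_le_one hδ,
          ENNReal.ofReal_one]
    _ ≤ _ := by
        refine ENNReal.tsum_le_tsum fun s => ?_
        rw [← ENNReal.ofReal_mul (by positivity), ← ENNReal.ofReal_pow (by positivity)]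
        refine ENNReal.ofReal_le_ofReal ?_
        rw [mul_pow, inv_pow, mul_comm]
        gcongr
        calc 1 + δ ≤ Real.exp δ := by linarith [Real.add_one_le_exp δ]
          _ ≤ Real.exp δ ^ ((s : ℕ) + 1) :=
            le_self_pow₀ (Real.one_le_exp hδ) (by omega)

lemma log_sub_le_entropy_perturb {S : Set ℕ} {w : List (Fin 2)} {lam δ : ℝ} (hlam : 1 ≤ lam)
    (h : TR S lam = 1) (hw : w ≠ [])
    (hform : ¬ ∃ u : List (Fin 2), (1 : Fin 2) ∈ u ∧ w = 0 :: (u ++ [0])) (hδ0 : 0 ≤ δ)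
    (hz1 : lam⁻¹ * Real.exp δ < 1)
    (hδ : (lam⁻¹ * Real.exp δ) ^ w.length / (1 - lam⁻¹ * Real.exp δ) ≤ δ) :
    Real.log lam - δ ≤ entropy (perturb (SgapShift S) w) := by
  have hz0 : 0 < lam⁻¹ * Real.exp δ := by positivity
  have hlog : Real.log (lam⁻¹ * Real.exp δ) = δ - Real.log lam := by
    rw [Real.log_mul (by positivity) (by positivity), Real.log_inv, Real.log_exp]
    ring
  refine le_entropy (fun x hx => hx.1) hlam (sum_inv_pow_le_one hlam h) fun N hN => ?_
  have h1 := one_le_ncard_langN_perturb hw hform hz0 hz1 hδ (one_add_le_tsum_gaps hlam h hδ0) N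
  have hcard : ((langN (perturb (SgapShift S) w) N).ncard : ℝ) ≠ 0 := by
    intro h0
    rw [h0, zero_mul] at h1
    linarith
  have h2 := Real.log_nonneg h1
  rw [Real.log_mul hcard (by positivity), Real.log_pow, hlog] at h2
  rw [le_div_iff₀ (by exact_mod_cast hN)]
  linarith

/-- Exponential decay of the entropy drop for perturbations of an `S`-gap shift
by words that do not both begin and end with `0` around a `1`. -/
theorem sgap_entropy_drop_exponential (S : Set ℕ) (hS : S.Nonempty)
    (lamS : ℝ) (hlam1 : 1 ≤ lamS) (hlamS : TR S lamS = 1) :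
    ∃ (C : ℝ) (N₀ : ℕ), 0 < C ∧ 0 < N₀ ∧ ∀ n : ℕ, N₀ < n →
      ∀ w ∈ langN (SgapShift S) n,
        (¬ ∃ u : List (Fin 2), (1 : Fin 2) ∈ u ∧ w = 0 :: (u ++ [0])) →
        0 ≤ entropy (SgapShift S) - entropy (perturb (SgapShift S) w) ∧
          entropy (SgapShift S) - entropy (perturb (SgapShift S) w) ≤ C * (lamS ^ n)⁻¹ := by
  have hsum := fun N => sum_inv_pow_le_one hlam1 hlamS N
  have hup := entropy_SgapShift_le hlam1 hsum
  have hmono : ∀ w, entropy (perturb (SgapShift S) w) ≤ entropy (SgapShift S) := fun w =>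
    entropy_mono (fun x hx => hx.1) hlam1 hsum
  rcases hlam1.eq_or_lt with rfl | hlt
  · refine ⟨1, 1, one_pos, one_pos, fun n _ w _ _ => ⟨sub_nonneg.2 (hmono w), ?_⟩⟩
    have h0 : 0 ≤ entropy (perturb (SgapShift S) w) :=
      le_entropy (fun x hx => hx.1) le_rfl hsum fun N _ => log_ncard_div_nonneg N
    rw [Real.log_one] at hup
    simp only [one_pow, inv_one, mul_one]
    linarith
  have hL : 0 < Real.log lamS := Real.log_pos hlt
  set q := Real.exp (-(Real.log lamS / 2)) with hq
  have hq1 : q < 1 := Real.exp_lt_one_iff.2 (by linarith)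
  set C := 2 / (1 - q) with hC
  have hCpos : 0 < C := div_pos two_pos (by linarith)
  have hlim : Tendsto (fun n : ℕ => C * (n * lamS⁻¹ ^ n)) atTop (𝓝 0) := by
    simpa using (tendsto_self_mul_const_pow_of_lt_one (by positivity)
      (inv_lt_one_of_one_lt₀ hlt)).const_mul C
  obtain ⟨N₀, hN₀⟩ := eventually_atTop.1
    (hlim.eventually (ge_mem_nhds (lt_min (Real.log_pos one_lt_two) (half_pos hL))))
  refine ⟨C, N₀ + 1, hCpos, by omega, fun n hn w hw hform => ⟨sub_nonneg.2 (hmono w), ?_⟩⟩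
  have hbound := hN₀ n (by omega)
  rw [le_min_iff] at hbound
  set δ := C * (lamS ^ n)⁻¹ with hδ
  have hδ0 : 0 ≤ δ := by positivity
  have hnδ : C * (n * lamS⁻¹ ^ n) = n * δ := by rw [hδ, inv_pow]; ring
  rw [hnδ] at hbound
  have hn1 : (1 : ℝ) ≤ n := by exact_mod_cast (show 1 ≤ n by omega)
  have hδL : δ ≤ Real.log lamS / 2 := (le_mul_of_one_le_left hδ0 hn1).trans hbound.2
  have hzq : lamS⁻¹ * Real.exp δ ≤ q := by
    rw [hq, ← Real.exp_log (show 0 < lamS⁻¹ by positivity), ← Real.exp_add, Real.log_inv]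
    exact Real.exp_le_exp.2 (by linarith)
  have hwn : w.length = n := hw.2
  have hlow : Real.log lamS - δ ≤ entropy (perturb (SgapShift S) w) := by
    refine log_sub_le_entropy_perturb hlam1 hlamS ?_ hform hδ0 (hzq.trans_lt hq1) ?_
    · rintro rfl
      simp at hwn
      omega
    · have hexp : Real.exp δ ^ n ≤ 2 := by
        rw [← Real.exp_nat_mul, ← Real.exp_log two_pos]
        exact Real.exp_le_exp.2 hbound.1
      have h1q : 0 < 1 - q := by linarith
      calc (lamS⁻¹ * Real.exp δ) ^ w.length / (1 - lamS⁻¹ * Real.exp δ)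
          ≤ (lamS⁻¹ * Real.exp δ) ^ w.length / (1 - q) := by gcongr
        _ = (lamS ^ n)⁻¹ * Real.exp δ ^ n / (1 - q) := by rw [hwn, mul_pow, inv_pow]
        _ ≤ (lamS ^ n)⁻¹ * 2 / (1 - q) := by gcongr
        _ = δ := by rw [hδ, hC]; ring
  linarith
end

section
/- Let A be a finite alphabet and x, y ∈ A^ℕ with x ≠ y; let u_n = x_1⋯x_n and w_n = y_1⋯y_n be their length-n prefixes. Then for every real z > 1, lim_{n→∞} z^{−(n−1)} (u_n, w_n)_z equals: 0, if σ^m x ≠ y for every m > 0; z^{−m}, if m is the least positive integer with σ^m x = y and both x and y are non-periodic; z^{−m}/(1 − z^{−s}), if m is the least positive integer with σ^m x = y, x is non-periodic, and y is periodic with least period s; and z^{−m}/(1 − z^{−t}), if m is the least positive integer with σ^m x = y and x is periodic with least period t. -/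
open Filter Topology

section Correlation

variable {A : Type*}

/-- `ℓ ∈ (u,w)`: overlap condition when the first symbol of `w` is placed below the
`(|u|-ℓ)`-th symbol of `u` (1-indexed); the overlapping parts agree. -/
def corrIdx (u w : List A) (ℓ : ℕ) : Prop :=
  ℓ < u.length ∧
    ∀ j : ℕ, j ≤ ℓ → j < w.length → u[u.length - 1 - ℓ + j]? = w[j]?

/-- The correlation set `(u,w) ⊆ {0,…,|u|−1}`. -/
def corrSet (u w : List A) : Set ℕ := { ℓ | corrIdx u w ℓ }

open scoped Classical in
/-- The correlation set, as a finset. -/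
noncomputable def corrFinset (u w : List A) : Finset ℕ :=
  (Finset.range u.length).filter (corrIdx u w)

/-- The correlation polynomial `(u,w)_z = Σ_{ℓ ∈ (u,w)} z^ℓ`. -/
noncomputable def corrPoly (u w : List A) (z : ℝ) : ℝ :=
  ∑ ℓ ∈ corrFinset u w, z ^ ℓ

end Correlation

/-- The length-`n` prefix `x_1 ⋯ x_n` of a one-sided sequence. -/
def prefixWord {A : Type*} (x : ℕ → A) (n : ℕ) : List A := (List.range n).map x

/-- `ℓ` belongs to the correlation set of two length-`n` prefixes exactly when the shift of `x` by
`n - 1 - ℓ` agrees with `y` inside the window of length `n`. -/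
theorem corrIdx_prefixWord_iff {A : Type*} (x y : ℕ → A) {n k : ℕ} (hk : k < n) :
    corrIdx (prefixWord x n) (prefixWord y n) (n - 1 - k) ↔
      ∀ j, k + j < n → x (k + j) = y j := by
  have hkn : n - 1 - (n - 1 - k) = k := by omega
  simp only [corrIdx, prefixWord, List.length_map, List.length_range, hkn]
  constructor
  · rintro ⟨-, h⟩ j hj
    have := h j (by omega) (by omega)
    rw [List.getElem?_eq_getElem (by simpa using hj),
      List.getElem?_eq_getElem (by simp; omega)] at this
    simpa using this
  · refine fun h => ⟨by omega, fun j hj hjn => ?_⟩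
    have hkj : k + j < n := by omega
    rw [List.getElem?_eq_getElem (by simpa using hkj),
      List.getElem?_eq_getElem (by simpa using hjn)]
    simpa using h j hkj

open scoped Classical in
theorem corrPoly_prefixWord_div {A : Type*} (x y : ℕ → A) {z : ℝ} (hz : z ≠ 0) (n : ℕ) :
    corrPoly (prefixWord x n) (prefixWord y n) z / z ^ (n - 1) =
      ∑' k, if k < n ∧ ∀ j, k + j < n → x (k + j) = y j then z⁻¹ ^ k else 0 := by
  rw [tsum_eq_sum (s := Finset.range n) fun k hk =>
    if_neg fun h => hk (Finset.mem_range.2 h.1)]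
  have hlen : (prefixWord x n).length = n := by simp [prefixWord]
  rw [corrPoly, corrFinset, hlen, Finset.sum_filter, Finset.sum_div,
    ← Finset.sum_range_reflect]
  refine Finset.sum_congr rfl fun k hk => ?_
  have hk : k < n := Finset.mem_range.1 hk
  simp only [corrIdx_prefixWord_iff x y hk, hk, true_and, ite_div, zero_div]
  congr 1
  rw [div_eq_iff (pow_ne_zero _ hz), inv_pow, eq_inv_mul_iff_mul_eq₀ (pow_ne_zero _ hz),
    ← pow_add]
  congr 1
  omega

open scoped Classical in
theorem tendsto_corrPoly_prefixWord_div {A : Type*} (x y : ℕ → A) {z : ℝ} (hz : 1 < z) :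
    Tendsto (fun n : ℕ => corrPoly (prefixWord x n) (prefixWord y n) z / z ^ (n - 1)) atTop
      (𝓝 (∑' k, if (fun i => x (i + k)) = y then z⁻¹ ^ k else 0)) := by
  have hz0 : 0 < z := zero_lt_one.trans hz
  simp only [corrPoly_prefixWord_div x y hz0.ne']
  refine tendsto_tsum_of_dominated_convergence (bound := fun k => z⁻¹ ^ k)
    (summable_geometric_of_lt_one (inv_nonneg.2 hz0.le) (inv_lt_one_of_one_lt₀ hz))
    (fun k => ?_) (Eventually.of_forall fun n k => ?_)
  · refine tendsto_const_nhds.congr' ?_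
    by_cases h : (fun i => x (i + k)) = y
    · filter_upwards [eventually_gt_atTop k] with n hn
      rw [if_pos h, if_pos ⟨hn, fun j _ => by rw [← h, add_comm]⟩]
    · obtain ⟨j, hj⟩ := Function.ne_iff.1 h
      filter_upwards [eventually_gt_atTop (k + j)] with n hn
      rw [if_neg h, if_neg fun h' => hj (by rw [add_comm]; exact h'.2 j hn)]
  · have hnonneg : 0 ≤ z⁻¹ ^ k := by positivity
    split_ifs
    · exact (Real.norm_of_nonneg hnonneg).le
    · simpa using hnonneg

/-- The least period of a sequence divides all its periods. -/
theorem dvd_of_periodic_of_minimal {A : Type*} {y : ℕ → A} {s d : ℕ} (hs : 0 < s)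
    (hy : Function.Periodic y s) (hmin : ∀ t, 0 < t → t < s → ¬ Function.Periodic y t)
    (hd : Function.Periodic y d) : s ∣ d := by
  by_contra hsd
  refine hmin (d % s) (Nat.pos_of_ne_zero fun h => hsd (Nat.dvd_of_mod_eq_zero h))
    (Nat.mod_lt _ hs) fun i => ?_
  have hmul : Function.Periodic y (d / s * s) := hy.nat_mul (d / s)
  rw [← hmul (i + d % s), add_assoc, add_comm (d % s), Nat.div_add_mod', hd]

/-- Two shifts of `x` that both equal `y` differ by a period of `y`. -/
theorem shift_eq_iff_periodic {A : Type*} {x y : ℕ → A} {m : ℕ}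
    (hm : (fun i => x (i + m)) = y) (d : ℕ) :
    (fun i => x (i + (m + d))) = y ↔ Function.Periodic y d := by
  subst hm
  simp only [funext_iff, Function.Periodic]
  refine forall_congr' fun i => ?_
  rw [add_assoc, add_comm d m]

/-- Every period of a shift of a periodic sequence is a period of the sequence. -/
theorem periodic_of_periodic_shift {A : Type*} {x : ℕ → A} {m t d : ℕ} (ht : 0 < t)
    (hx : Function.Periodic x t) (hd : Function.Periodic (fun i => x (i + m)) d) :
    Function.Periodic x d := by
  intro i
  have hmul : Function.Periodic x (m * t) := hx.nat_mul m
  have hle : m ≤ m * t := Nat.le_mul_of_pos_right m ht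
  have h := hd (i + (m * t - m))
  rw [← hmul (i + d), ← hmul i]
  convert h using 2 <;> omega

open scoped Classical in
theorem tsum_shift_of_periodic {A : Type*} {x y : ℕ → A} {m s : ℕ} {z : ℝ} (hz : 1 < z)
    (hm : (fun i => x (i + m)) = y)
    (hmin : ∀ k < m, (fun i => x (i + k)) ≠ y) (hs : 0 < s)
    (hy : Function.Periodic y s) (hsmin : ∀ t, 0 < t → t < s → ¬ Function.Periodic y t) :
    (∑' k, if (fun i => x (i + k)) = y then z⁻¹ ^ k else 0) =
      (z ^ m)⁻¹ / (1 - (z ^ s)⁻¹) := by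
  have hinj : Function.Injective fun i : ℕ => m + i * s := fun a b hab =>
    Nat.eq_of_mul_eq_mul_right hs (Nat.add_left_cancel hab)
  have hlt : (z ^ s)⁻¹ < 1 := inv_lt_one_of_one_lt₀ (one_lt_pow₀ hz hs.ne')
  refine HasSum.tsum_eq ?_
  rw [← hinj.hasSum_iff]
  · rw [div_eq_mul_inv]
    refine Eq.subst (motive := fun f : ℕ → ℝ => HasSum f _) (funext fun i => ?_)
      ((hasSum_geometric_of_lt_one (by positivity) hlt).mul_left (z ^ m)⁻¹)
    have hmul : Function.Periodic y (i * s) := hy.nat_mul i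
    rw [Function.comp_apply, if_pos ((shift_eq_iff_periodic hm _).2 hmul), pow_add,
      mul_comm i, pow_mul, inv_pow z, inv_pow z]
  · refine fun k hk => if_neg fun h => hk ?_
    obtain ⟨d, rfl⟩ := Nat.exists_eq_add_of_le (not_lt.1 fun hkm => hmin k hkm h)
    obtain ⟨c, rfl⟩ :=
      dvd_of_periodic_of_minimal hs hy hsmin ((shift_eq_iff_periodic hm d).1 h)
    exact ⟨c, by simp only [mul_comm]⟩

/-- Limits of the normalized cross-correlation polynomials of the prefixes of two
distinct one-sided sequences. -/
theorem crosscorrelation_limit {A : Type*} [Fintype A] (x y : ℕ → A) (hxy : x ≠ y)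
    (z : ℝ) (hz : 1 < z) :
    ((∀ m : ℕ, 0 < m → (fun i => x (i + m)) ≠ y) →
      Filter.Tendsto
        (fun n : ℕ => corrPoly (prefixWord x n) (prefixWord y n) z / z ^ (n - 1))
        Filter.atTop (nhds 0)) ∧
    (∀ m : ℕ, 0 < m → (fun i => x (i + m)) = y →
      (∀ m' : ℕ, 0 < m' → m' < m → (fun i => x (i + m')) ≠ y) →
      ((∀ s : ℕ, 0 < s → ¬ Function.Periodic x s) →
        (∀ s : ℕ, 0 < s → ¬ Function.Periodic y s) →
        Filter.Tendsto
          (fun n : ℕ => corrPoly (prefixWord x n) (prefixWord y n) z / z ^ (n - 1))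
          Filter.atTop (nhds ((z ^ m)⁻¹))) ∧
      (∀ s : ℕ, 0 < s → Function.Periodic y s →
        (∀ t : ℕ, 0 < t → t < s → ¬ Function.Periodic y t) →
        (∀ t : ℕ, 0 < t → ¬ Function.Periodic x t) →
        Filter.Tendsto
          (fun n : ℕ => corrPoly (prefixWord x n) (prefixWord y n) z / z ^ (n - 1))
          Filter.atTop (nhds ((z ^ m)⁻¹ / (1 - (z ^ s)⁻¹)))) ∧
      (∀ t : ℕ, 0 < t → Function.Periodic x t →
        (∀ t' : ℕ, 0 < t' → t' < t → ¬ Function.Periodic x t') →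
        Filter.Tendsto
          (fun n : ℕ => corrPoly (prefixWord x n) (prefixWord y n) z / z ^ (n - 1))
          Filter.atTop (nhds ((z ^ m)⁻¹ / (1 - (z ^ t)⁻¹))))) := by
  have hshift : ∀ m : ℕ, (∀ m' : ℕ, 0 < m' → m' < m → (fun i => x (i + m')) ≠ y) →
      ∀ k < m, (fun i => x (i + k)) ≠ y := by
    intro m hmin k hk
    rcases Nat.eq_zero_or_pos k with rfl | hk0
    · exact hxy
    · exact hmin k hk0 hk
  have hlim := tendsto_corrPoly_prefixWord_div x y hz
  refine ⟨fun h => ?_, fun m _ hm hmin => ⟨fun _ hy => ?_, fun s hs hy hsmin _ => ?_,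
    fun t ht hx htmin => ?_⟩⟩
  · convert hlim
    rw [tsum_congr fun k => if_neg ?_, tsum_zero]
    exact hshift (k + 1) (fun m' h0 _ => h m' h0) k k.lt_succ_self
  · convert hlim
    rw [tsum_eq_single m, if_pos hm, inv_pow]
    refine fun k hk => if_neg fun h => ?_
    obtain ⟨d, rfl⟩ := Nat.exists_eq_add_of_le (not_lt.1 fun hkm => hshift m hmin k hkm h)
    exact hy d (by omega) ((shift_eq_iff_periodic hm d).1 h)
  · rwa [tsum_shift_of_periodic hz hm (hshift m hmin) hs hy hsmin] at hlim
  · have hy : Function.Periodic y t := by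
      rw [← hm]
      exact fun i => by simpa only [add_right_comm] using hx (i + m)
    rwa [tsum_shift_of_periodic hz hm (hshift m hmin) ht hy fun t' h0 hlt hp =>
      htmin t' h0 hlt (periodic_of_periodic_shift ht hx (by rwa [hm]))] at hlim
end
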